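/- arXiv:1708.00877 — 11 statements merged into one kernel-verified Lean document; each statement's English description precedes it below -/
import Mathlib

section
/- The Morse–Thue dynamical system (M₀, σ) cannot be presented as a strict inverse limit of finite dynamical systems: for every sequence (X_n)_{n∈ℕ} of finite discrete topological spaces with ℤ-actions and surjective ℤ-equivariant bonding maps p_n : X_{n+1} → X_n, there is no homeomorphism from M₀ to the inverse limit X = {x ∈ ∏_n X_n : p_n(x_{n+1}) = x_n for all n} that intertwines the shift action of ℤ on M₀ with the induced ℤ-action on X. -/
/-- The Morse–Thue sequence: `morseThue n` is the parity of the number of `1`s in the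
binary expansion of `n`. -/
def morseThue (n : ℕ) : ZMod 2 := ((Nat.digits 2 n).count 1 : ZMod 2)

/-- The two-sided Morse–Thue sequence, obtained by concatenating the Morse–Thue sequence
with its reverse. -/
def omega0 : ℤ → ZMod 2 := fun n => if 0 ≤ n then morseThue n.toNat else morseThue (-n - 1).toNat

/-- `M₀`: the closure in `(ℤ/2)^ℤ` (product topology, `ℤ/2` discrete) of the orbit of the
two-sided Morse–Thue sequence under the shift. -/
def morseThueM0 : Set (ℤ → ZMod 2) :=
  closure {x | ∃ k : ℤ, x = fun n => omega0 (n + k)}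

/-- `M₀` is invariant under all powers of the shift. -/
lemma shift_mem_morseThueM0 (k : ℤ) {x : ℤ → ZMod 2} (hx : x ∈ morseThueM0) :
    (fun n => x (n + k)) ∈ morseThueM0 := by
  have hc : Continuous (fun (y : ℤ → ZMod 2) => fun n => y (n + k)) :=
    continuous_pi fun n => continuous_apply (n + k)
  have h1 : (fun n => x (n + k)) ∈
      closure ((fun (y : ℤ → ZMod 2) => fun n => y (n + k)) ''
        {x | ∃ j : ℤ, x = fun n => omega0 (n + j)}) :=
    mem_closure_image hc.continuousAt hx
  refine closure_mono ?_ h1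
  rintro y ⟨z, ⟨j, rfl⟩, rfl⟩
  exact ⟨j + k, by funext n; simp only []; ring_nf⟩

lemma morseThue_zero : morseThue 0 = 0 := by simp [morseThue]

lemma morseThue_two_mul (n : ℕ) : morseThue (2 * n) = morseThue n := by
  rcases Nat.eq_zero_or_pos n with rfl | hn
  · rfl
  · simp [morseThue, Nat.digits_def' one_lt_two (show 0 < 2 * n by omega)]

lemma morseThue_two_mul_add_one (n : ℕ) : morseThue (2 * n + 1) = morseThue n + 1 := by
  have h : (2 * n + 1) / 2 = n := by omega
  simp [morseThue, h]

lemma morseThue_two_mul_add (n b : ℕ) (hb : b < 2) :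
    morseThue (2 * n + b) = morseThue n + (b : ZMod 2) := by
  interval_cases b
  · simp [morseThue_two_mul]
  · simp [morseThue_two_mul_add_one]

lemma morseThue_mul_two_pow_add (k a b : ℕ) (hb : b < 2 ^ k) :
    morseThue (a * 2 ^ k + b) = morseThue a + morseThue b := by
  induction k generalizing b with
  | zero =>
    obtain rfl : b = 0 := by simpa using hb
    simp [morseThue_zero]
  | succ k ih =>
    have hsplit : a * 2 ^ (k + 1) + b = 2 * (a * 2 ^ k + b / 2) + b % 2 := by
      rw [pow_succ, ← mul_assoc]; omega
    have hb' : morseThue b = morseThue (b / 2) + ((b % 2 : ℕ) : ZMod 2) := by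
      rw [← morseThue_two_mul_add _ _ (Nat.mod_lt b two_pos), Nat.div_add_mod]
    rw [hsplit, morseThue_two_mul_add _ _ (Nat.mod_lt b two_pos),
      ih (b / 2) (by rw [pow_succ] at hb; omega), hb', add_assoc]

/-- If `a + c = 2 ^ k - 1`, then the binary expansions of `a` and `c` on `k` bits are
complementary. -/
lemma morseThue_add_of_add_eq (k a c : ℕ) (h : a + c + 1 = 2 ^ k) :
    morseThue a + morseThue c = k := by
  induction k generalizing a c with
  | zero =>
    obtain ⟨rfl, rfl⟩ : a = 0 ∧ c = 0 := by simpa using h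
    simp [morseThue_zero]
  | succ k ih =>
    rw [pow_succ] at h
    have hk := ih (a / 2) (c / 2) (by omega)
    have hbits : ((a % 2 : ℕ) : ZMod 2) + ((c % 2 : ℕ) : ZMod 2) = 1 := by
      rw [← Nat.cast_add, show a % 2 + c % 2 = 1 by omega, Nat.cast_one]
    rw [← Nat.div_add_mod a 2, ← Nat.div_add_mod c 2,
      morseThue_two_mul_add _ _ (Nat.mod_lt a two_pos),
      morseThue_two_mul_add _ _ (Nat.mod_lt c two_pos), Nat.cast_succ, ← hk, ← hbits]
    ring

/-- The Morse–Thue sequence takes the value `1` on the multiples of any positive integer. -/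
lemma exists_morseThue_mul_eq_one (m : ℕ) (hm : 0 < m) : ∃ j : ℕ, morseThue (j * m) = 1 := by
  obtain ⟨a, rfl⟩ : ∃ a, m = a + 1 := ⟨m - 1, by omega⟩
  have hlt : a + 1 < 2 ^ (2 * a + 1) :=
    lt_of_le_of_lt (by omega) (Nat.lt_two_pow_self (n := 2 * a + 1))
  obtain ⟨c, hc⟩ := Nat.exists_eq_add_of_lt hlt
  refine ⟨2 ^ (2 * a + 1) - 1, ?_⟩
  have hmul : (2 ^ (2 * a + 1) - 1) * (a + 1) = a * 2 ^ (2 * a + 1) + (c + 1) := by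
    rw [Nat.sub_mul, mul_add, mul_comm _ a]; omega
  rw [hmul, morseThue_mul_two_pow_add _ _ _ (by omega),
    morseThue_add_of_add_eq (2 * a + 1) _ _ (by omega)]
  have h2 : (2 : ZMod 2) = 0 := by decide
  push_cast
  rw [h2, zero_mul, zero_add]

lemma exists_pos_forall_mul_vadd_eq {Y : Type*} [Finite Y] [AddAction ℤ Y] (y : Y) :
    ∃ m : ℕ, 0 < m ∧ ∀ j : ℕ, (((j * m : ℕ) : ℤ) +ᵥ y) = y := by
  obtain ⟨k, l, hkl, h⟩ := Finite.exists_ne_map_eq_of_infinite fun k : ℤ => k +ᵥ y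
  have hper : k - l ∈ AddAction.stabilizer ℤ y := by
    rw [AddAction.mem_stabilizer_iff, sub_eq_neg_add, add_vadd]
    exact (congrArg (-l +ᵥ ·) h).trans (neg_vadd_vadd l y)
  have habs : ((k - l).natAbs : ℤ) ∈ AddAction.stabilizer ℤ y := by
    rcases Int.natAbs_eq (k - l) with h' | h'
    · rwa [← h']
    · rw [h', neg_mem_iff] at hper
      exact hper
  refine ⟨(k - l).natAbs, Int.natAbs_pos.2 (sub_ne_zero.2 hkl), fun j => ?_⟩
  have hj := nsmul_mem habs j
  rwa [nsmul_eq_mul, ← Nat.cast_mul, AddAction.mem_stabilizer_iff] at hj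

lemma omega0_natCast (n : ℕ) : omega0 n = morseThue n := by simp [omega0]

lemma omega0_mem_morseThueM0 : omega0 ∈ morseThueM0 :=
  subset_closure ⟨0, by simp⟩

/-- The Morse–Thue system `(M₀, σ)` cannot be presented as a strict inverse limit of finite
dynamical systems: for every sequence of finite discrete `ℤ`-spaces with surjective
equivariant bonding maps, no homeomorphism from `M₀` to the inverse limit intertwines the
shift action with the induced action. -/
theorem stmt_1 (X : ℕ → Type) [∀ n, Finite (X n)] [∀ n, AddAction ℤ (X n)]
    (p : ∀ n, X (n + 1) → X n)
    (hsurj : ∀ n, Function.Surjective (p n))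
    (hequiv : ∀ (n : ℕ) (g : ℤ) (x : X (n + 1)), p n (g +ᵥ x) = g +ᵥ p n x) :
    letI : ∀ n, TopologicalSpace (X n) := fun _ => ⊥
    ¬ ∃ e : ↥morseThueM0 ≃ₜ {x : ∀ n, X n // ∀ n, p n (x (n + 1)) = x n},
        ∀ (k : ℤ) (x : ↥morseThueM0),
          ((e ⟨fun n => x.1 (n + k), shift_mem_morseThueM0 k x.2⟩ :
              {x : ∀ n, X n // ∀ n, p n (x (n + 1)) = x n}) : ∀ n, X n) =
            fun n => k +ᵥ ((e x : {x : ∀ n, X n // ∀ n, p n (x (n + 1)) = x n}) : ∀ n, X n) n := by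
  let _ : ∀ n, TopologicalSpace (X n) := fun _ => ⊥
  rintro ⟨e, he⟩
  let w : morseThueM0 := ⟨omega0, omega0_mem_morseThueM0⟩
  let S : Set morseThueM0 := {y | y.1 0 = omega0 0}
  have hcont : Continuous fun y : morseThueM0 => y.1 0 :=
    (continuous_apply (A := fun _ : ℤ => ZMod 2) 0).comp continuous_subtype_val
  have hS : IsOpen S := (isOpen_discrete {omega0 0}).preimage hcont
  obtain ⟨V, hV, hVS⟩ := isOpen_induced_iff.1 (hS.preimage e.symm.continuous)
  have hmem : ∀ y, (e y).1 ∈ V ↔ y ∈ S := fun y => by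
    simpa using Set.ext_iff.1 hVS (e y)
  obtain ⟨I, u, hu, huV⟩ := isOpen_pi_iff.1 hV (e w).1 ((hmem w).2 rfl)
  obtain ⟨m, hm, hper⟩ := exists_pos_forall_mul_vadd_eq fun i : I => (e w).1 i
  obtain ⟨j, hj⟩ := exists_morseThue_mul_eq_one m hm
  have hshift := (hmem ⟨_, shift_mem_morseThueM0 ((j * m : ℕ) : ℤ) w.2⟩).1 <| huV fun i hi => by
    rw [he _ w]
    have hi' := congrFun (hper j) ⟨i, hi⟩
    rw [Pi.vadd_apply] at hi'
    simpa only [hi'] using (hu i hi).2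
  have hval : omega0 (0 + ((j * m : ℕ) : ℤ)) = omega0 0 := hshift
  rw [zero_add, omega0_natCast, hj, ← Nat.cast_zero, omega0_natCast, morseThue_zero] at hval
  exact one_ne_zero hval
end

section
/- Let f : ℤ̂₂ → ℤ̂₃ be a homeomorphism from the 2-adic integers to the 3-adic integers, and suppose a ∈ ℤ̂₂ and b ∈ ℤ̂₃ satisfy f(x + a) = f(x) + b for every x ∈ ℤ̂₂. Then a = 0 and b = 0. -/
open Filter Topology

/-- An element of `ℤ_[q]` whose multiples by powers of a prime `p ≠ q` tend to zero is zero. -/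
theorem PadicInt.eq_zero_of_tendsto_pow_mul {p q : ℕ} [hp : Fact p.Prime] [hq : Fact q.Prime]
    (hpq : p ≠ q) {b : ℤ_[q]}
    (hb : Tendsto (fun k : ℕ => (p : ℤ_[q]) ^ k * b) atTop (𝓝 0)) : b = 0 := by
  have hnorm : ‖(p : ℤ_[q])‖ = 1 :=
    PadicInt.norm_natCast_eq_one_iff.mpr ((Nat.coprime_primes hq.out hp.out).mpr hpq.symm)
  have hlim := hb.norm
  simp only [norm_mul, norm_pow, hnorm, one_pow, one_mul, norm_zero] at hlim
  exact norm_eq_zero.mp (tendsto_nhds_unique tendsto_const_nhds hlim)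

/-- If `f : ℤ̂₂ → ℤ̂₃` is a homeomorphism and `a ∈ ℤ̂₂`, `b ∈ ℤ̂₃` satisfy
`f (x + a) = f x + b` for every `x`, then `a = 0` and `b = 0`. -/
theorem stmt_3 (f : ℤ_[2] ≃ₜ ℤ_[3]) (a : ℤ_[2]) (b : ℤ_[3])
    (h : ∀ x : ℤ_[2], f (x + a) = f x + b) : a = 0 ∧ b = 0 := by
  have hmul (n : ℕ) : f (n * a) = f 0 + n * b := by
    induction n with
    | zero => simp
    | succ n ih => rw [Nat.cast_succ, add_one_mul, h, ih]; push_cast; ring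
  have hpow : Tendsto (fun k : ℕ => ((2 : ℕ) : ℤ_[2]) ^ k * a) atTop (𝓝 0) := by
    simpa using (tendsto_pow_atTop_nhds_zero_of_norm_lt_one
      (PadicInt.norm_natCast_lt_one_iff.mpr (dvd_refl 2))).mul_const a
  have hb : b = 0 := by
    refine PadicInt.eq_zero_of_tendsto_pow_mul (p := 2) (by norm_num) ?_
    have hlim := ((f.continuous.tendsto 0).comp hpow).sub_const (f 0)
    rw [sub_self] at hlim
    refine hlim.congr fun k => ?_
    have hk := hmul (2 ^ k)
    rw [Nat.cast_pow, Nat.cast_pow] at hk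
    simp only [Function.comp_apply, hk, add_sub_cancel_left]
  refine ⟨f.injective ?_, hb⟩
  simpa [hb] using h 0
end

section
/- Fix n ∈ ℕ. Let Hₙ := {x ∈ (S¹)^ℕ : there exists an index j such that for all i ≠ j, x_i ∈ {1, −1} if i < n and x_i = 1 if i ≥ n}, a subspace of the countable product (S¹)^ℕ, and let H₀ := {y ∈ (S¹)^ℕ : y_i = 1 for all but at most one index i}. Define qₙ : Hₙ → H₀ by (qₙ(x))_i = x_i² for i < n and (qₙ(x))_i = x_i for i ≥ n. Then qₙ is a covering map. -/
/-- The Hawaiian-earring-like subspace `H₀` of `(S¹)^ℕ`: sequences equal to `1` at all but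
at most one index. -/
def Hzero : Set (ℕ → Circle) := {y | {i | y i ≠ 1}.Subsingleton}

/-- The space `Hₙ`: sequences with at most one free coordinate `j`, whose other coordinates
are `±1` below `n` and `1` from `n` on. -/
def Hn (n : ℕ) : Set (ℕ → Circle) :=
  {x | ∃ j : ℕ, ∀ i : ℕ, i ≠ j →
    if i < n then (x i = 1 ∨ (x i : ℂ) = -1) else x i = 1}

lemma sq_eq_one_of {z : Circle} (hz : z = 1 ∨ (z : ℂ) = -1) : z ^ 2 = 1 := by
  rcases hz with h | h
  · rw [h, one_pow]
  · have h2 : ((z ^ 2 : Circle) : ℂ) = (z : ℂ) ^ 2 := by norm_cast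
    apply Circle.coe_injective
    rw [h2, h]
    norm_num

/-- The covering map `qₙ : Hₙ → H₀`, squaring the first `n` coordinates. -/
noncomputable def qn (n : ℕ) (x : ↥(Hn n)) : ↥Hzero :=
  ⟨fun i => if i < n then x.1 i ^ 2 else x.1 i, by
    obtain ⟨j, hj⟩ := x.2
    refine (Set.subsingleton_singleton (a := j)).anti ?_
    intro i hi
    simp only [Set.mem_setOf_eq] at hi
    simp only [Set.mem_singleton_iff]
    by_contra hij
    have h := hj i hij
    by_cases hlt : i < n
    · rw [if_pos hlt] at hi h
      exact hi (sq_eq_one_of h)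
    · rw [if_neg hlt] at hi h
      exact hi h⟩

lemma Circle.sq_eq_one_iff {z : Circle} : z ^ 2 = 1 ↔ z = 1 ∨ (z : ℂ) = -1 := by
  refine ⟨fun h ↦ ?_, sq_eq_one_of⟩
  have h' : (z : ℂ) ^ 2 = 1 := by rw [← Circle.coe_pow, h, Circle.coe_one]
  simpa [Circle.coe_eq_one] using h'

/-- The endomorphism of `(S¹)^ℕ` squaring the first `n` coordinates. -/
noncomputable def sqBelow (n : ℕ) : (ℕ → Circle) →* (ℕ → Circle) where
  toFun x i := if i < n then x i ^ 2 else x i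
  map_one' := by ext1 i; simp
  map_mul' x y := by ext1 i; by_cases h : i < n <;> simp [h, mul_pow]

lemma sqBelow_apply (n : ℕ) (x : ℕ → Circle) (i : ℕ) :
    sqBelow n x i = if i < n then x i ^ 2 else x i := rfl

lemma sqBelow_apply_eq_one_iff (n : ℕ) (x : ℕ → Circle) (i : ℕ) :
    sqBelow n x i = 1 ↔ if i < n then (x i = 1 ∨ (x i : ℂ) = -1) else x i = 1 := by
  rw [sqBelow_apply]
  split_ifs
  · exact Circle.sq_eq_one_iff
  · rfl

lemma continuous_sqBelow (n : ℕ) : Continuous (sqBelow n) := by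
  refine continuous_pi fun i ↦ ?_
  simp only [sqBelow_apply]
  split_ifs <;> fun_prop

lemma sqBelow_surjective (n : ℕ) : Function.Surjective (sqBelow n) := by
  intro y
  choose r hr using (Circle.isQuotientCoveringMap_npow 2).surjective
  refine ⟨fun i ↦ if i < n then r (y i) else y i, ?_⟩
  ext1 i
  rw [sqBelow_apply]
  split_ifs
  · exact hr (y i)
  · rfl

lemma finite_ker_sqBelow (n : ℕ) : ((sqBelow n).ker : Set (ℕ → Circle)).Finite := by
  have hfin : {z : Circle | z ^ 2 = 1}.Finite := by
    refine Set.Finite.of_finite_image (f := ((↑) : Circle → ℂ))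
      (Set.Finite.subset (Set.toFinite {1, -1}) ?_) Circle.coe_injective.injOn
    rintro _ ⟨z, hz, rfl⟩
    rcases Circle.sq_eq_one_iff.1 hz with h | h <;> simp [h]
  refine Set.Finite.of_injOn (f := fun x (i : Fin n) ↦ x i) ?_ ?_
    (Set.Finite.pi' fun _ : Fin n ↦ hfin)
  · intro x hx i
    simpa [sqBelow_apply] using congrFun (MonoidHom.mem_ker.1 hx) i
  · intro x hx y hy hxy
    ext1 i
    by_cases hi : i < n
    · exact congrFun hxy ⟨i, hi⟩
    · have hx' := congrFun (MonoidHom.mem_ker.1 hx) i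
      have hy' := congrFun (MonoidHom.mem_ker.1 hy) i
      rw [sqBelow_apply, if_neg hi] at hx' hy'
      rw [hx', hy']

lemma isCoveringMap_sqBelow (n : ℕ) : IsCoveringMap (sqBelow n) :=
  (Topology.IsQuotientMap.isQuotientCoveringMap_of_isDiscrete_ker_monoidHom
    ((continuous_sqBelow n).isClosedMap.isQuotientMap (continuous_sqBelow n) (sqBelow_surjective n))
    (finite_ker_sqBelow n).isDiscrete).isCoveringMap

lemma preimage_sqBelow_Hzero (n : ℕ) : sqBelow n ⁻¹' Hzero = Hn n := by
  ext x
  simp only [Hn, Set.mem_ofPred_eq, ← sqBelow_apply_eq_one_iff]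
  constructor
  · intro h
    by_cases hne : ∃ j, sqBelow n x j ≠ 1
    · obtain ⟨j, hj⟩ := hne
      exact ⟨j, fun i hij ↦ by_contra fun hi ↦ hij (h hi hj)⟩
    · push Not at hne
      exact ⟨0, fun i _ ↦ hne i⟩
  · rintro ⟨j, hj⟩
    exact Set.subsingleton_singleton.anti fun i hi ↦ by_contra fun hij ↦ hi (hj i hij)

lemma qn_eq_restrictPreimage (n : ℕ) :
    qn n = Hzero.restrictPreimage (sqBelow n) ∘
      Homeomorph.setCongr (preimage_sqBelow_Hzero n).symm := rfl

/-- `qₙ : Hₙ → H₀` is a covering map. -/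
theorem stmt_7 (n : ℕ) : Function.Surjective (qn n) ∧ IsCoveringMap (qn n) := by
  rw [qn_eq_restrictPreimage]
  exact ⟨(Hzero.restrictPreimage_surjective (sqBelow_surjective n)).comp
      (Homeomorph.surjective _),
    ((isCoveringMap_sqBelow n).restrictPreimage Hzero).comp_homeomorph _⟩
end

section
/- Let H_∞ := {x ∈ (S¹)^ℕ : x_i ∈ {1, −1} for all but at most one index i}, and for each n let Hₙ := {x ∈ (S¹)^ℕ : there exists an index j such that for all i ≠ j, x_i ∈ {1, −1} if i < n and x_i = 1 if i ≥ n}, with bonding maps pₙ₊₁ : Hₙ₊₁ → Hₙ given by squaring the n-th coordinate and leaving all other coordinates unchanged. For each n define rₙ : H_∞ → Hₙ by (rₙ(x))_i = x_i for i < n and (rₙ(x))_i = x_i² for i ≥ n. Then rₙ = pₙ₊₁ ∘ rₙ₊₁ for all n, and the induced map x ↦ (rₙ(x))ₙ is a homeomorphism from H_∞ onto the inverse limit {(yₙ) ∈ ∏ₙ Hₙ : pₙ₊₁(yₙ₊₁) = yₙ for all n} (with the subspace topology of the product). -/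
/-- The space `H_∞`: sequences in `(S¹)^ℕ` with all but at most one coordinate in `{1, -1}`. -/
def Hinf : Set (ℕ → Circle) := {x | {i | x i ≠ 1 ∧ (x i : ℂ) ≠ -1}.Subsingleton}

lemma Hinf_exists_j {x : ℕ → Circle} (hx : x ∈ Hinf) :
    ∃ j : ℕ, ∀ i, i ≠ j → (x i = 1 ∨ (x i : ℂ) = -1) := by
  by_cases h : ∃ j, x j ≠ 1 ∧ (x j : ℂ) ≠ -1
  · obtain ⟨j, hj⟩ := h
    refine ⟨j, fun i hij => ?_⟩
    by_contra hc
    push_neg at hc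
    exact hij (hx hc hj)
  · push_neg at h
    refine ⟨0, fun i _ => ?_⟩
    by_contra hc
    push_neg at hc
    exact hc.2 (h i hc.1)

/-- The bonding map `pₙ₊₁ : Hₙ₊₁ → Hₙ`, squaring the `n`-th coordinate. -/
noncomputable def pbond (n : ℕ) (x : ↥(Hn (n + 1))) : ↥(Hn n) :=
  ⟨fun i => if i = n then x.1 i ^ 2 else x.1 i, by
    obtain ⟨j, hj⟩ := x.2
    refine ⟨j, fun i hij => ?_⟩
    have h := hj i hij
    simp only []
    by_cases hin : i = n
    · subst hin
      rw [if_pos (Nat.lt_succ_self i)] at h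
      rw [if_neg (lt_irrefl i), if_pos rfl]
      exact sq_eq_one_of h
    · by_cases hlt : i < n
      · rw [if_pos (by omega : i < n + 1)] at h
        rw [if_pos hlt, if_neg hin]
        exact h
      · rw [if_neg (by omega : ¬ i < n + 1)] at h
        rw [if_neg hlt, if_neg hin]
        exact h⟩

/-- The map `rₙ : H_∞ → Hₙ`: identity on coordinates below `n`, squaring from `n` on. -/
noncomputable def rn (n : ℕ) (x : ↥Hinf) : ↥(Hn n) :=
  ⟨fun i => if i < n then x.1 i else x.1 i ^ 2, by
    obtain ⟨j, hj⟩ := Hinf_exists_j x.2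
    refine ⟨j, fun i hij => ?_⟩
    simp only []
    by_cases hlt : i < n
    · rw [if_pos hlt, if_pos hlt]
      exact hj i hij
    · rw [if_neg hlt, if_neg hlt]
      exact sq_eq_one_of (hj i hij)⟩

lemma rn_compat (n : ℕ) (x : ↥Hinf) : pbond n (rn (n + 1) x) = rn n x := by
  apply Subtype.ext
  funext i
  show (if i = n then (if i < n + 1 then x.1 i else x.1 i ^ 2) ^ 2
      else (if i < n + 1 then x.1 i else x.1 i ^ 2)) =
    (if i < n then x.1 i else x.1 i ^ 2)
  by_cases hin : i = n
  · subst hin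
    rw [if_pos rfl, if_pos (Nat.lt_succ_self i), if_neg (lt_irrefl i)]
  · rw [if_neg hin]
    by_cases hlt : i < n
    · rw [if_pos (by omega : i < n + 1), if_pos hlt]
    · rw [if_neg (by omega : ¬ i < n + 1), if_neg hlt]

/-- One coordinate of the compatibility condition of the inverse limit. -/
lemma coord_of_compat {y : ∀ n : ℕ, ↥(Hn n)} (hy : ∀ n : ℕ, pbond n (y (n + 1)) = y n)
    (n i : ℕ) : (y n).1 i = if i = n then (y (n + 1)).1 i ^ 2 else (y (n + 1)).1 i :=
  (congrFun (congrArg Subtype.val (hy n)) i).symm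

lemma coord_eq_of_lt {y : ∀ n : ℕ, ↥(Hn n)} (hy : ∀ n : ℕ, pbond n (y (n + 1)) = y n)
    {n i : ℕ} (h : i < n) : (y n).1 i = (y (i + 1)).1 i := by
  induction n, h using Nat.le_induction with
  | base => rfl
  | succ n hn ih =>
    rw [← ih, coord_of_compat hy n i, if_neg (by omega)]

lemma coord_eq_of_le {y : ∀ n : ℕ, ↥(Hn n)} (hy : ∀ n : ℕ, pbond n (y (n + 1)) = y n)
    {n i : ℕ} (h : n ≤ i) : (y n).1 i = (y (i + 1)).1 i ^ 2 := by
  induction h using Nat.decreasingInduction with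
  | self => rw [coord_of_compat hy i i, if_pos rfl]
  | of_succ k hk ih => rw [coord_of_compat hy k i, if_neg (by omega), ih]

/-- The diagonal `i ↦ (y (i + 1)) i` of a compatible sequence lies in `H_∞`. -/
lemma diag_mem_Hinf {y : ∀ n : ℕ, ↥(Hn n)} (hy : ∀ n : ℕ, pbond n (y (n + 1)) = y n) :
    (fun i => (y (i + 1)).1 i) ∈ Hinf := by
  intro i hi k hk
  by_contra hik
  obtain ⟨j, hj⟩ := (y (i + k + 1)).2
  have key : ∀ l, l < i + k + 1 → l ≠ j →
      (y (l + 1)).1 l = 1 ∨ ((y (l + 1)).1 l : ℂ) = -1 := by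
    intro l hl hlj
    have h := hj l hlj
    rwa [if_pos hl, coord_eq_of_lt hy hl] at h
  by_cases hij : i = j
  · exact (key k (by omega) (by omega)).elim hk.1 hk.2
  · exact (key i (by omega) hij).elim hi.1 hi.2

lemma continuous_rn (n : ℕ) : Continuous (rn n) := by
  refine Continuous.subtype_mk (continuous_pi fun i => ?_) _
  have hc : Continuous fun x : ↥Hinf => x.1 i := (continuous_apply i).comp continuous_subtype_val
  by_cases h : i < n
  · simpa only [if_pos h] using hc
  · simp only [if_neg h]
    exact (continuous_pow 2).comp hc

/-- The homeomorphism from `H_∞` onto the inverse limit, with inverse the diagonal map. -/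
noncomputable def homeomorphInverseLimit :
    ↥Hinf ≃ₜ {y : ∀ n : ℕ, ↥(Hn n) // ∀ n : ℕ, pbond n (y (n + 1)) = y n} where
  toFun x := ⟨fun n => rn n x, fun n => rn_compat n x⟩
  invFun y := ⟨fun i => (y.1 (i + 1)).1 i, diag_mem_Hinf y.2⟩
  left_inv x := Subtype.ext <| funext fun i => if_pos (Nat.lt_succ_self i)
  right_inv y := by
    refine Subtype.ext <| funext fun n => Subtype.ext <| funext fun i => ?_
    change (if i < n then (y.1 (i + 1)).1 i else (y.1 (i + 1)).1 i ^ 2) = (y.1 n).1 i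
    split_ifs with h
    · exact (coord_eq_of_lt y.2 h).symm
    · exact (coord_eq_of_le y.2 (not_lt.mp h)).symm
  continuous_toFun := Continuous.subtype_mk (continuous_pi continuous_rn) _
  continuous_invFun := by
    refine Continuous.subtype_mk (continuous_pi fun i => ?_) _
    have hy : Continuous fun y : {y : ∀ n : ℕ, ↥(Hn n) // ∀ n : ℕ, pbond n (y (n + 1)) = y n} =>
        y.1 (i + 1) := (continuous_apply (i + 1)).comp continuous_subtype_val
    exact (continuous_apply i).comp (continuous_subtype_val.comp hy)

/-- `rₙ = pₙ₊₁ ∘ rₙ₊₁` for all `n`, and the induced map is a homeomorphism from `H_∞`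
onto the inverse limit of the sequence `(Hₙ, pₙ₊₁)`. -/
theorem stmt_8 :
    (∀ (n : ℕ) (x : ↥Hinf), rn n x = pbond n (rn (n + 1) x)) ∧
    IsHomeomorph (fun x : ↥Hinf =>
      (⟨fun n => rn n x, fun n => rn_compat n x⟩ :
        {y : ∀ n : ℕ, ↥(Hn n) // ∀ n : ℕ, pbond n (y (n + 1)) = y n})) := by
  exact ⟨fun n x => (rn_compat n x).symm, homeomorphInverseLimit.isHomeomorph⟩
end

section
/- Let H_∞ := {x ∈ (S¹)^ℕ : x_i ∈ {1, −1} for all but at most one index i} and H₀ := {y ∈ (S¹)^ℕ : y_i = 1 for all but at most one index i}, and let p_∞ : H_∞ → H₀ be the componentwise squaring map, (p_∞(x))_i = x_i². Then p_∞ has the unique path lifting property: for every continuous path γ : [0,1] → H₀ and every point e ∈ H_∞ with p_∞(e) = γ(0), there exists a unique continuous path γ̃ : [0,1] → H_∞ such that p_∞ ∘ γ̃ = γ and γ̃(0) = e. -/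
/-- The componentwise squaring map `p_∞ : H_∞ → H₀`. -/
noncomputable def pinf (x : ↥Hinf) : ↥Hzero :=
  ⟨fun i => x.1 i ^ 2, by
    obtain ⟨j, hj⟩ := Hinf_exists_j x.2
    refine (Set.subsingleton_singleton (a := j)).anti ?_
    intro i hi
    simp only [Set.mem_setOf_eq] at hi
    simp only [Set.mem_singleton_iff]
    by_contra hij
    exact hi (sq_eq_one_of (hj i hij))⟩

theorem Circle.isCoveringMap_sq : IsCoveringMap (fun z : Circle => z ^ 2) :=
  (Circle.isQuotientCoveringMap_npow 2).isCoveringMap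

/-- A sequence whose componentwise square lies in `H₀` belongs to `H_∞`. -/
lemma mem_Hinf_of_sq_eq {x : ℕ → Circle} {y : ↥Hzero} (h : ∀ i, x i ^ 2 = y.1 i) :
    x ∈ Hinf := by
  refine y.2.anti fun i hi hy => ?_
  have hsq : (x i : ℂ) ^ 2 = 1 := by
    rw [← Circle.coe_pow, h i, hy, Circle.coe_one]
  rcases eq_or_eq_neg_of_sq_eq_sq (x i : ℂ) 1 (by rw [hsq, one_pow]) with h1 | h1
  · exact hi.1 (Circle.coe_injective h1)
  · exact hi.2 h1

/-- `p_∞ : H_∞ → H₀` has the unique path lifting property. -/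
theorem stmt_10 (γ : unitInterval → ↥Hzero) (hγ : Continuous γ)
    (e : ↥Hinf) (he : pinf e = γ 0) :
    ∃! γ' : unitInterval → ↥Hinf,
      Continuous γ' ∧ (∀ t, pinf (γ' t) = γ t) ∧ γ' 0 = e := by
  let γc (i : ℕ) : C(unitInterval, Circle) :=
    ⟨fun t => (γ t).1 i, (continuous_apply i).comp (continuous_subtype_val.comp hγ)⟩
  have h0 (i : ℕ) : γc i 0 = e.1 i ^ 2 := (congrFun (congrArg Subtype.val he) i).symm
  let L (i : ℕ) : C(unitInterval, Circle) :=
    Circle.isCoveringMap_sq.liftPath (γc i) (e.1 i) (h0 i)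
  have hL (i : ℕ) (t : unitInterval) : L i t ^ 2 = (γ t).1 i :=
    congrFun (Circle.isCoveringMap_sq.liftPath_lifts (γc i) (e.1 i) (h0 i)) t
  refine ⟨fun t => ⟨fun i => L i t, mem_Hinf_of_sq_eq fun i => hL i t⟩, ⟨?_, ?_, ?_⟩, ?_⟩
  · exact (continuous_pi fun i => (L i).continuous).subtype_mk _
  · exact fun t => Subtype.ext (funext fun i => hL i t)
  · exact Subtype.ext (funext fun i =>
      Circle.isCoveringMap_sq.liftPath_zero (γc i) (e.1 i) (h0 i))
  · rintro δ ⟨hδ, hδγ, hδ0⟩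
    have key (i : ℕ) : (fun t => (δ t).1 i) = L i :=
      (Circle.isCoveringMap_sq.eq_liftPath_iff (h0 i)).mpr
        ⟨(continuous_apply i).comp (continuous_subtype_val.comp hδ),
          funext fun t => congrFun (congrArg Subtype.val (hδγ t)) i, by rw [hδ0]⟩
    exact funext fun t => Subtype.ext (funext fun i => congrFun (key i) t)
end

section
/- Let H_∞ := {x ∈ (S¹)^ℕ : x_i ∈ {1, −1} for all but at most one index i} and H₀ := {y ∈ (S¹)^ℕ : y_i = 1 for all but at most one index i}, and let p_∞ : H_∞ → H₀ be the componentwise squaring map, (p_∞(x))_i = x_i². Then p_∞ is not a covering map. -/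
lemma mulSingle_mem_Hinf (n : ℕ) {z : Circle} : Pi.mulSingle n z ∈ Hinf := by
  refine (Set.subsingleton_singleton (a := n)).anti fun i hi => ?_
  by_contra hin
  exact hi.1 (Pi.mulSingle_eq_of_ne (M := fun _ => Circle) hin z)

lemma pinf_mulSingle (n : ℕ) {z : Circle} (hz : z ^ 2 = 1) :
    pinf ⟨Pi.mulSingle n z, mulSingle_mem_Hinf n⟩ = ⟨1, by simp [Hzero]⟩ := by
  apply Subtype.ext
  change Pi.mulSingle n z ^ 2 = (1 : ℕ → Circle)
  rw [← Pi.mulSingle_pow, hz, Pi.mulSingle_one]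

lemma tendsto_mulSingle_one {M : Type*} [TopologicalSpace M] [One M] (z : M) :
    Filter.Tendsto (fun n : ℕ => (Pi.mulSingle n z : ℕ → M)) Filter.atTop (nhds 1) := by
  refine tendsto_pi_nhds.mpr fun i => tendsto_const_nhds.congr' ?_
  filter_upwards [Filter.eventually_gt_atTop i] with n hn
  exact (Pi.mulSingle_eq_of_ne (M := fun _ => M) hn.ne z).symm

/-- `p_∞ : H_∞ → H₀` is not a covering map. -/
theorem stmt_11 : ¬ IsCoveringMap pinf := by
  intro h
  obtain ⟨z, hz⟩ : ∃ z : Circle, (z : ℂ) = -1 := ⟨Circle.exp Real.pi, by simp⟩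
  have hz2 : z ^ 2 = 1 := sq_eq_one_of (Or.inr hz)
  have hz1 : z ≠ 1 := by
    rintro rfl
    norm_num [Complex.ext_iff] at hz
  have := (h ⟨1, by simp [Hzero]⟩).discreteTopology_fiber
  let u (w : {w : Circle // w ^ 2 = 1}) (n : ℕ) : pinf ⁻¹' {⟨1, by simp [Hzero]⟩} :=
    ⟨⟨Pi.mulSingle n w.1, mulSingle_mem_Hinf n⟩, pinf_mulSingle n w.2⟩
  have hu : Filter.Tendsto (u ⟨z, hz2⟩) Filter.atTop (nhds (u ⟨1, one_pow 2⟩ 0)) := by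
    refine tendsto_subtype_rng.mpr (tendsto_subtype_rng.mpr ?_)
    simpa [u] using tendsto_mulSingle_one z
  rw [nhds_discrete, Filter.tendsto_pure] at hu
  obtain ⟨n, hn⟩ := hu.exists
  apply hz1
  simpa [u] using congrArg (fun x => x.1.1 n) hn
end

section
/- Let H₀ := {y ∈ (S¹)^ℕ : y_i = 1 for all but at most one index i} (a space homeomorphic to the Hawaiian earring), with base point b the constant sequence 1. Then there exists a surjective group homomorphism from the fundamental group π₁(H₀, b) onto the group (ℤ/2)^ℕ, the unrestricted direct product of countably many copies of ℤ/2. -/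
/-- The base point of `H₀`: the constant sequence `1`. -/
noncomputable def basept : ↥Hzero := ⟨fun _ => 1, fun _ hi _ _ => absurd rfl hi⟩

open Real in
/-- Reduction mod `2` of the winding number, on the deck group of `Circle.exp`. -/
theorem exists_zmultiples_two_pi_hom :
    ∃ h : AddSubgroup.zmultiples (2 * π) →+ ZMod 2,
      ∀ (n : ℕ) (g : AddSubgroup.zmultiples (2 * π)), (g : ℝ) = n * (2 * π) → h g = n := by
  have hinj : Function.Injective (zmultiplesHom ℝ (2 * π)) := by
    intro a b hab
    simpa [Real.pi_ne_zero] using hab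
  let e := AddMonoidHom.ofInjective hinj
  let j : AddSubgroup.zmultiples (2 * π) →+ (zmultiplesHom ℝ (2 * π)).range :=
    AddSubgroup.inclusion (fun x hx => by
      obtain ⟨k, rfl⟩ := hx
      exact ⟨k, rfl⟩)
  refine ⟨(Int.castAddHom (ZMod 2)).comp (e.symm.toAddMonoidHom.comp j), fun n g hg => ?_⟩
  have hj : j g = e (n : ℤ) := by
    apply Subtype.ext
    change (g : ℝ) = (n : ℤ) • (2 * π)
    simp [hg]
  change ((e.symm (j g) : ℤ) : ZMod 2) = n
  rw [hj, e.symm_apply_apply]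
  simp

/-- The projection of `H₀` to its `i`-th circle. -/
def Hzero.coord (i : ℕ) : C(↥Hzero, Circle) :=
  ⟨fun y => y.1 i, (continuous_apply i).comp continuous_subtype_val⟩

/-- The base point of the fibre of `Circle.exp` over `1`. -/
noncomputable def Hzero.fiberZero (i : ℕ) : Circle.exp ⁻¹' {Hzero.coord i basept} :=
  ⟨0, Circle.exp_zero⟩

/-- The winding number around the `i`-th circle, as an element of the deck group of
`Circle.exp`. -/
noncomputable def Hzero.winding (i : ℕ) :
    FundamentalGroup ↥Hzero basept →*
      (Multiplicative (AddSubgroup.zmultiples (2 * Real.pi)))ᵐᵒᵖ :=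
  (Circle.isAddQuotientCoveringMap_exp.fundamentalGroupToMulOpposite
    (Hzero.fiberZero i)).comp (FundamentalGroup.map (Hzero.coord i) basept)

theorem Hzero.winding_eq_of_lift (i : ℕ) (γ : Path basept basept) (Γ : C(unitInterval, ℝ))
    (hΓ : ∀ t, Circle.exp (Γ t) = (γ t).1 i) (h0 : Γ 0 = 0) :
    ((Hzero.winding i (.fromPath (.mk γ))).unop.toAdd : ℝ) = Γ 1 := by
  have h := Circle.isAddQuotientCoveringMap_exp.unop_fundamentalGroupToMulOpposite_smul
    (e := Hzero.fiberZero i)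
    (γ := FundamentalGroup.map (Hzero.coord i) basept (.fromPath (.mk γ)))
  have hz : ((Hzero.winding i (.fromPath (.mk γ))).unop.toAdd : ℝ) + (Hzero.fiberZero i).1 =
      Circle.isAddQuotientCoveringMap_exp.isCoveringMap.monodromy
        (Path.Homotopic.Quotient.mk (γ.map (Hzero.coord i).continuous)) (Hzero.fiberZero i) := h
  have hf : (Hzero.fiberZero i).1 = 0 := rfl
  rw [hf, add_zero] at hz
  rw [hz]
  have hl := (Circle.isAddQuotientCoveringMap_exp.isCoveringMap.eq_liftPath_iff'
    (γ := (γ.map (Hzero.coord i).continuous : C(unitInterval, Circle)))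
    (e := 0) (γ_0 := by simp [Hzero.coord, basept]) (Γ := Γ)).mpr ⟨funext hΓ, h0⟩
  exact (congr($hl 1)).symm

/-- The ramp that increases from `0` to `1` on `[i / (i + 1), (i + 1) / (i + 2)]` and is constant
elsewhere. -/
noncomputable def ramp (i : ℕ) (t : ℝ) : ℝ :=
  max 0 (min 1 ((t * (i + 1) - i) * (i + 2)))

theorem continuous_ramp (i : ℕ) : Continuous (ramp i) := by
  unfold ramp
  fun_prop

theorem ramp_zero (i : ℕ) : ramp i 0 = 0 := by
  unfold ramp
  apply max_eq_left
  apply min_le_of_right_le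
  have : (0 : ℝ) ≤ i := i.cast_nonneg
  nlinarith

theorem ramp_one (i : ℕ) : ramp i 1 = 1 := by
  unfold ramp
  have : (0 : ℝ) ≤ i := i.cast_nonneg
  rw [min_eq_left (by nlinarith)]
  simp

theorem ramp_eq_zero_or_one {i j : ℕ} (hij : i < j) (t : ℝ) : ramp i t = 1 ∨ ramp j t = 0 := by
  unfold ramp
  have hi : (0 : ℝ) ≤ i := i.cast_nonneg
  have hij' : (i : ℝ) + 1 ≤ j := by exact_mod_cast hij
  by_cases h : t * (j + 1) - j ≤ 0
  · right
    exact max_eq_left (min_le_of_right_le (mul_nonpos_of_nonpos_of_nonneg h (by positivity)))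
  · left
    have h1 : 1 ≤ (t * (i + 1) - i) * (i + 2) := by
      have ht : (i : ℝ) + 1 ≤ t * (i + 2) := by
        by_contra! hc
        nlinarith [mul_pos (sub_pos.mpr hc) (by linarith : (0 : ℝ) < j + 1)]
      nlinarith
    rw [min_eq_left h1]
    simp

/-- The loop in `H₀` that runs `n i` times around the `i`-th circle during
`[i / (i + 1), (i + 1) / (i + 2)]`. -/
noncomputable def Hzero.infiniteLoop (n : ℕ → ℕ) : Path basept basept where
  toFun t := ⟨fun i => Circle.exp (n i * (2 * Real.pi) * ramp i t), by
    have key : ∀ i j : ℕ, i < j → Circle.exp (n i * (2 * Real.pi) * ramp i t) ≠ 1 →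
        Circle.exp (n j * (2 * Real.pi) * ramp j t) ≠ 1 → False := by
      intro i j hij hi hj
      rcases ramp_eq_zero_or_one hij (t : ℝ) with h | h
      · exact hi (by rw [h, mul_one]; exact Circle.exp_eq_one.mpr ⟨n i, by simp⟩)
      · exact hj (by rw [h, mul_zero, Circle.exp_zero])
    intro i hi j hj
    rcases lt_trichotomy i j with h | h | h
    · exact (key i j h hi hj).elim
    · exact h
    · exact (key j i h hj hi).elim⟩
  continuous_toFun := by
    refine Continuous.subtype_mk (continuous_pi fun i => ?_) _
    exact Circle.exp.continuous.comp
      (continuous_const.mul ((continuous_ramp i).comp continuous_subtype_val))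
  source' := by
    apply Subtype.ext
    funext i
    simp [ramp_zero, basept]
  target' := by
    apply Subtype.ext
    funext i
    simp [ramp_one, basept]

theorem Hzero.winding_infiniteLoop (n : ℕ → ℕ) (i : ℕ) :
    ((Hzero.winding i (.fromPath (.mk (Hzero.infiniteLoop n)))).unop.toAdd : ℝ) =
      n i * (2 * Real.pi) := by
  rw [Hzero.winding_eq_of_lift i (Hzero.infiniteLoop n)
    ⟨fun t => n i * (2 * Real.pi) * ramp i t,
      continuous_const.mul ((continuous_ramp i).comp continuous_subtype_val)⟩
    (fun _ => rfl) (by simp [ramp_zero])]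
  simp [ramp_one]

/-- There is a surjective group homomorphism from the fundamental group of `H₀`
(at the constant sequence `1`) onto `(ℤ/2)^ℕ`. -/
theorem stmt_13 :
    ∃ φ : FundamentalGroup ↥Hzero basept →* Multiplicative (ℕ → ZMod 2),
      Function.Surjective φ := by
  obtain ⟨h, hh⟩ := exists_zmultiples_two_pi_hom
  refine ⟨MonoidHom.mk' (fun γ => .ofAdd fun i => h (Hzero.winding i γ).unop.toAdd) ?_, ?_⟩
  · intro a b
    rw [← ofAdd_add]
    congr 1
    funext i
    rw [map_mul, MulOpposite.unop_mul, toAdd_mul, map_add, add_comm]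
    rfl
  · intro a
    refine ⟨.fromPath (.mk (Hzero.infiniteLoop fun i => (a.toAdd i).val)), ?_⟩
    apply Multiplicative.toAdd.injective
    funext i
    exact (hh _ _ (Hzero.winding_infiniteLoop _ i)).trans (ZMod.natCast_zmod_val _)
end

section
/- Let Sol₂ := {x ∈ (S¹)^ℕ : x_{n+1}² = x_n for all n ∈ ℕ} (the dyadic solenoid), and let p : Sol₂ → S¹ be the projection p(x) = x₀. Then p has the unique path lifting property: for every continuous path γ : [0,1] → S¹ and every point e ∈ Sol₂ with p(e) = γ(0), there exists a unique continuous path γ̃ : [0,1] → Sol₂ such that p ∘ γ̃ = γ and γ̃(0) = e. -/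
/-- The dyadic solenoid: the inverse limit of the squaring self-maps of the circle,
realized as a subspace of `(S¹)^ℕ`. -/
def Sol2 : Set (ℕ → Circle) := {x | ∀ n : ℕ, x (n + 1) ^ 2 = x n}

/-- Continuous maps from a preconnected space to the circle with equal squares agree everywhere
once they agree at a point. -/
theorem Circle.eq_of_sq_eq {X : Type*} [TopologicalSpace X] [PreconnectedSpace X]
    {f g : X → Circle} (hf : Continuous f) (hg : Continuous g) (hsq : ∀ x, f x ^ 2 = g x ^ 2)
    {x₀ : X} (h₀ : f x₀ = g x₀) (x : X) : f x = g x := by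
  refine Circle.ext ?_
  refine isPreconnected_univ.eq_of_sq_eq (f := fun y ↦ (f y : ℂ)) (g := fun y ↦ (g y : ℂ))
    (by fun_prop) (by fun_prop) (fun y _ ↦ ?_) (fun _ ↦ Circle.coe_ne_zero _) (Set.mem_univ x₀)
    (congrArg _ h₀) (Set.mem_univ x)
  simpa using congrArg ((↑) : Circle → ℂ) (hsq y)

/-- Every path in the circle has a continuous argument. -/
theorem Circle.exists_continuous_exp_eq (γ : unitInterval → Circle) (hγ : Continuous γ) :
    ∃ θ : unitInterval → ℝ, Continuous θ ∧ ∀ t, Circle.exp (θ t) = γ t := by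
  obtain ⟨a, ha⟩ := Circle.exp_surjective (γ 0)
  obtain ⟨Γ, hΓ, -⟩ := Circle.isCoveringMap_exp.exists_path_lifts ⟨γ, hγ⟩ a ha.symm
  exact ⟨Γ, Γ.continuous, congrFun hΓ⟩

/-- The projection `Sol₂ → S¹`, `x ↦ x₀`, has the unique path lifting property. -/
theorem stmt_15 (γ : unitInterval → Circle) (hγ : Continuous γ)
    (e : ↥Sol2) (he : e.1 0 = γ 0) :
    ∃! γ' : unitInterval → ↥Sol2,
      Continuous γ' ∧ (∀ t, (γ' t).1 0 = γ t) ∧ γ' 0 = e := by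
  refine existsUnique_of_exists_of_unique ?_ ?_
  · obtain ⟨θ, hθ, hexp⟩ := Circle.exists_continuous_exp_eq γ hγ
    refine ⟨fun t ↦ ⟨fun n ↦ e.1 n * Circle.exp ((θ t - θ 0) / 2 ^ n), fun n ↦ ?_⟩,
      ?_, fun t ↦ ?_, ?_⟩
    · rw [mul_pow, e.2 n, sq (Circle.exp _), ← Circle.exp_add]
      congr 2
      field_simp
      ring
    · refine Continuous.subtype_mk (continuous_pi fun n ↦ ?_) _
      fun_prop
    · simp [Circle.exp_sub, hexp, he]
    · ext n : 2
      simp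
  · rintro f g ⟨hf, hf₀, hfe⟩ ⟨hg, hg₀, hge⟩
    have h : ∀ n t, (f t).1 n = (g t).1 n := by
      intro n
      induction n with
      | zero => exact fun t ↦ (hf₀ t).trans (hg₀ t).symm
      | succ n ih =>
        refine Circle.eq_of_sq_eq ((continuous_apply (n + 1)).comp (continuous_subtype_val.comp hf))
          ((continuous_apply (n + 1)).comp (continuous_subtype_val.comp hg))
          (fun t ↦ ?_) (x₀ := 0) (by simp [hfe, hge])
        rw [(f t).2 n, (g t).2 n, ih t]
    exact funext fun t ↦ Subtype.ext (funext fun n ↦ h n t)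
end

section
/- The dyadic solenoid Sol₂ := {x ∈ (S¹)^ℕ : x_{n+1}² = x_n for all n ∈ ℕ} is connected, but it is neither path-connected nor locally path-connected. -/
open Filter Topology

namespace Sol2

/-- The one-parameter subgroup `t ↦ (exp (t / 2 ^ n))ₙ` of the dyadic solenoid. -/
noncomputable def leaf (t : ℝ) : Sol2 :=
  ⟨fun n => Circle.exp (t / 2 ^ n), fun n => by
    rw [← Circle.exp_nsmul]
    congr 1
    simp only [nsmul_eq_mul, Nat.cast_ofNat, pow_succ]
    field_simp⟩

theorem continuous_leaf : Continuous leaf := by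
  unfold leaf
  fun_prop

theorem apply_eq_pow (x : Sol2) (n k : ℕ) : x.1 n = x.1 (n + k) ^ 2 ^ k := by
  induction k with
  | zero => simp
  | succ k ih =>
    rw [ih, ← x.2 (n + k), ← pow_mul, ← pow_succ']
    rfl

theorem leaf_apply_of_le (x : Sol2) {n N : ℕ} (h : n ≤ N) :
    (leaf (2 ^ N * (x.1 N : ℂ).arg)).1 n = x.1 n := by
  obtain ⟨k, rfl⟩ := Nat.exists_eq_add_of_le h
  rw [apply_eq_pow _ n k, apply_eq_pow x n k]
  congr 1
  simp only [leaf]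
  rw [mul_div_cancel_left₀ _ (by positivity), Circle.exp_arg]

theorem denseRange_leaf : DenseRange leaf := by
  intro x
  refine mem_closure_of_tendsto (f := fun N : ℕ => leaf (2 ^ N * (x.1 N : ℂ).arg)) (b := atTop)
    ?_ (Eventually.of_forall fun N => Set.mem_range_self _)
  rw [tendsto_subtype_rng, tendsto_pi_nhds]
  intro n
  refine tendsto_const_nhds.congr' ?_
  filter_upwards [eventually_ge_atTop n] with N hN
  exact (leaf_apply_of_le x hN).symm

instance : ConnectedSpace Sol2 :=
  have := denseRange_leaf.preconnectedSpace continuous_leaf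
  { toNonempty := ⟨leaf 0⟩ }

theorem mem_range_leaf_of_joined {x : Sol2} (h : Joined (leaf 0) x) : x ∈ Set.range leaf := by
  obtain ⟨γ⟩ := h
  have hlift (n : ℕ) : ∃ θ : C(unitInterval, ℝ), θ 0 = 0 ∧ ∀ t, Circle.exp (θ t) = (γ t).1 n := by
    let g : C(unitInterval, Circle) :=
      ⟨fun t => (γ t).1 n, (continuous_apply n).comp (continuous_subtype_val.comp γ.continuous)⟩
    have hg : g 0 = Circle.exp 0 := by
      change (γ 0).1 n = _
      rw [γ.source]
      simp [leaf]
    refine ⟨Circle.isCoveringMap_exp.liftPath g 0 hg, ?_, fun t => ?_⟩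
    · exact Circle.isCoveringMap_exp.liftPath_zero g 0 hg
    · exact congrFun (Circle.isCoveringMap_exp.liftPath_lifts g 0 hg) t
  choose θ hθ₀ hθ using hlift
  have key (n : ℕ) : (fun t => 2 ^ n * θ n t) = θ 0 := by
    refine Circle.isCoveringMap_exp.eq_of_comp_eq (by fun_prop) (by fun_prop) ?_ 0 (by simp [hθ₀])
    funext t
    have h₁ := apply_eq_pow (γ t) 0 n
    rw [zero_add, ← hθ, ← hθ, ← Circle.exp_nsmul] at h₁
    simpa using h₁.symm
  refine ⟨θ 0 1, Subtype.ext (funext fun n => ?_)⟩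
  have h₂ := hθ n 1
  rw [γ.target] at h₂
  rw [← h₂, ← key n]
  simp only [leaf]
  rw [mul_div_cancel_left₀ _ (by positivity)]

theorem tendsto_leaf_apply (t : ℝ) : Tendsto (leaf t).1 atTop (𝓝 1) := by
  have h : Tendsto (fun n : ℕ => t / 2 ^ n) atTop (𝓝 0) :=
    tendsto_const_nhds.div_atTop (tendsto_pow_atTop_atTop_of_one_lt one_lt_two)
  rw [← Circle.exp_zero]
  exact (Circle.exp.continuous.tendsto 0).comp h

/-- The point `(ω, ω², ω, ω², …)` given by a cube root of unity `ω`. -/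
noncomputable def ofCubeRoot (ω : Circle) (h : ω ^ 3 = 1) : Sol2 :=
  ⟨fun n => ω ^ 2 ^ n, fun n => by
    rw [← pow_mul, show 2 ^ (n + 1) * 2 = 3 * 2 ^ n + 2 ^ n by ring, pow_add, pow_mul, h,
      one_pow, one_mul]⟩

theorem ofCubeRoot_apply_two_mul {ω : Circle} (h : ω ^ 3 = 1) (k : ℕ) :
    (ofCubeRoot ω h).1 (2 * k) = ω := by
  induction k with
  | zero => simp [ofCubeRoot]
  | succ k ih =>
    simp only [ofCubeRoot] at ih ⊢
    rw [show 2 ^ (2 * (k + 1)) = 2 ^ (2 * k) * (3 + 1) by ring, pow_mul, ih, pow_succ, h, one_mul]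

theorem ofCubeRoot_notMem_range_leaf {ω : Circle} (h : ω ^ 3 = 1) (hω : ω ≠ 1) :
    ofCubeRoot ω h ∉ Set.range leaf := by
  rintro ⟨t, ht⟩
  have h₁ : Tendsto (fun k : ℕ => (leaf t).1 (2 * k)) atTop (𝓝 1) :=
    (tendsto_leaf_apply t).comp (tendsto_id.const_mul_atTop' two_pos)
  simp only [ht, ofCubeRoot_apply_two_mul] at h₁
  exact hω (tendsto_nhds_unique tendsto_const_nhds h₁)

theorem exists_cubeRoot_ne_one : ∃ ω : Circle, ω ^ 3 = 1 ∧ ω ≠ 1 := by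
  refine ⟨Circle.exp (2 * Real.pi / 3), ?_, fun h => ?_⟩
  · rw [← Circle.exp_nsmul, ← Circle.exp_two_pi]
    congr 1
    simp only [nsmul_eq_mul, Nat.cast_ofNat]
    ring
  · have hπ := Real.pi_pos
    have h₁ := Circle.arg_exp (x := 2 * Real.pi / 3) (by linarith) (by linarith)
    rw [Circle.arg_eq_zero.mpr h] at h₁
    linarith

theorem not_pathConnectedSpace : ¬ PathConnectedSpace Sol2 := by
  intro _
  obtain ⟨ω, h, hω⟩ := exists_cubeRoot_ne_one
  exact ofCubeRoot_notMem_range_leaf h hω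
    (mem_range_leaf_of_joined (PathConnectedSpace.joined _ _))

end Sol2

/-- The dyadic solenoid is connected, but neither path-connected nor locally
path-connected. -/
theorem stmt_17 :
    ConnectedSpace ↥Sol2 ∧ ¬ PathConnectedSpace ↥Sol2 ∧ ¬ LocPathConnectedSpace ↥Sol2 := by
  refine ⟨inferInstance, Sol2.not_pathConnectedSpace, fun h => ?_⟩
  have : LocallyPathConnectedSpace Sol2 := h
  exact Sol2.not_pathConnectedSpace (pathConnectedSpace_iff_connectedSpace.mpr inferInstance)
end

section
/- Let Sol₂ := {x ∈ (S¹)^ℕ : x_{n+1}² = x_n for all n ∈ ℕ} and let p : Sol₂ → S¹ be the projection p(x) = x₀. Then p is not a covering map. -/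
open Filter Topology

/-- The thread of the dyadic solenoid that lies over the real number `t`. -/
noncomputable def Sol2.thread (t : ℝ) : Sol2 :=
  ⟨fun n => Circle.exp (t / 2 ^ n), fun n => by
    rw [← Circle.exp_nsmul]
    congr 1
    rw [nsmul_eq_mul, pow_succ]
    push_cast
    field_simp⟩

theorem Sol2.thread_apply_eq_one {k n : ℕ} (h : n ≤ k) :
    (Sol2.thread (2 ^ k * (2 * Real.pi))).1 n = 1 := by
  obtain ⟨m, rfl⟩ := Nat.exists_eq_add_of_le h
  refine Circle.exp_eq_one.2 ⟨2 ^ m, ?_⟩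
  rw [pow_add]
  push_cast
  field_simp

theorem Sol2.thread_apply_succ_ne_one (k : ℕ) :
    (Sol2.thread (2 ^ k * (2 * Real.pi))).1 (k + 1) ≠ 1 := by
  have h : (2 : ℝ) ^ k * (2 * Real.pi) / 2 ^ (k + 1) = Real.pi := by
    rw [pow_succ]
    field_simp
  exact fun h1 => Circle.exp_pi_ne_one (h ▸ h1)

theorem Sol2.tendsto_thread :
    Tendsto (fun k : ℕ => Sol2.thread (2 ^ k * (2 * Real.pi))) atTop (𝓝 (Sol2.thread 0)) := by
  refine tendsto_subtype_rng.2 (tendsto_pi_nhds.2 fun n => ?_)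
  refine tendsto_nhds_of_eventually_eq ?_
  filter_upwards [eventually_ge_atTop n] with k hk
  rw [Sol2.thread_apply_eq_one hk]
  simp [Sol2.thread]

/-- The projection `Sol₂ → S¹`, `x ↦ x₀`, is not a covering map. -/
theorem stmt_18 : ¬ IsCoveringMap (fun x : ↥Sol2 => x.1 0) := by
  intro h
  have := (h 1).discreteTopology_fiber
  let y (k : ℕ) : (fun x : ↥Sol2 => x.1 0) ⁻¹' {1} :=
    ⟨Sol2.thread (2 ^ k * (2 * Real.pi)), Sol2.thread_apply_eq_one k.zero_le⟩
  let z : (fun x : ↥Sol2 => x.1 0) ⁻¹' {1} := ⟨Sol2.thread 0, by simp [Sol2.thread]⟩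
  have hyz : Tendsto y atTop (𝓝 z) := tendsto_subtype_rng.2 Sol2.tendsto_thread
  rw [nhds_discrete, tendsto_pure] at hyz
  obtain ⟨k, hk⟩ := hyz.exists
  apply Sol2.thread_apply_succ_ne_one k
  have hk' : Sol2.thread (2 ^ k * (2 * Real.pi)) = Sol2.thread 0 := congrArg Subtype.val hk
  rw [hk']
  simp [Sol2.thread]
end

section
/- Let Sol₂ := {x ∈ (S¹)^ℕ : x_{n+1}² = x_n for all n ∈ ℕ} be the dyadic solenoid. If d is a positive integer for which there exists a continuous map g : Sol₂ → S¹ satisfying g(x)^d = x₀ for all x ∈ Sol₂ (that is, the projection x ↦ x₀ factors through the d-fold covering z ↦ z^d of the circle), then d is a power of 2. -/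
open Filter Topology

/-- The one-parameter subgroup `t ↦ (exp(i t / 2 ^ n))_n` of the dyadic solenoid. -/
noncomputable def Sol2.path (t : ℝ) : ↥Sol2 :=
  ⟨fun n => Circle.exp (t / 2 ^ n), fun n => by
    rw [sq, ← Circle.exp_add]
    congr 1
    field_simp
    ring⟩

theorem Sol2.continuous_path : Continuous Sol2.path := by
  unfold Sol2.path
  fun_prop

theorem Sol2.tendsto_path_two_pow :
    Tendsto (fun n : ℕ => Sol2.path (2 ^ n * (2 * Real.pi))) atTop (𝓝 (Sol2.path 0)) := by
  rw [tendsto_subtype_rng, tendsto_pi_nhds]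
  intro k
  refine tendsto_const_nhds.congr' ?_
  filter_upwards [eventually_ge_atTop k] with n hn
  obtain ⟨m, rfl⟩ := Nat.exists_eq_add_of_le hn
  have hm : (2 : ℝ) ^ (k + m) * (2 * Real.pi) / 2 ^ k = ((2 ^ m : ℤ) : ℝ) * (2 * Real.pi) := by
    push_cast
    field_simp
    ring
  simp only [Sol2.path, hm, Circle.exp_int_mul_two_pi]
  simp

theorem Circle.finite_setOf_pow_eq_one {d : ℕ} (hd : 0 < d) : {z : Circle | z ^ d = 1}.Finite := by
  refine ((Polynomial.nthRoots d (1 : ℂ)).toFinset.finite_toSet.preimage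
    Circle.coe_injective.injOn).subset fun z hz => ?_
  have hz' : (z : ℂ) ^ d = 1 := congrArg ((↑) : Circle → ℂ) hz
  simpa [Polynomial.mem_nthRoots hd] using hz'

/-- A continuous `d`-th root of `exp(i t)` is a constant multiple of `exp(i t / d)`. -/
theorem Circle.eq_mul_exp_div_of_pow_eq {d : ℕ} (hd : 0 < d) {f : ℝ → Circle}
    (hf : Continuous f) (h : ∀ t, f t ^ d = Circle.exp t) (t : ℝ) :
    f t = f 0 * Circle.exp (t / d) := by
  have hd' : (d : ℝ) ≠ 0 := by exact_mod_cast hd.ne'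
  have : Finite {z : Circle | z ^ d = 1} := Circle.finite_setOf_pow_eq_one hd
  have hmem : ∀ s, f s / Circle.exp (s / d) ∈ {z : Circle | z ^ d = 1} := fun s => by
    rw [Set.mem_ofPred_eq, div_pow, h, ← Circle.exp_nsmul, nsmul_eq_mul, mul_div_cancel₀ _ hd',
      div_self']
  have key := isPreconnected_univ.constant_of_mapsTo
    (f := fun s : ℝ => f s / Circle.exp (s / d)) (Set.toFinite _).isDiscrete
    (Continuous.continuousOn (by fun_prop))
    (fun s _ => hmem s) (Set.mem_univ t) (Set.mem_univ 0)
  simpa [div_eq_iff_eq_mul] using key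

/-- If the projection `Sol₂ → S¹`, `x ↦ x₀`, factors continuously through the `d`-fold
covering `z ↦ z^d` of the circle (for a positive integer `d`), then `d` is a power
of `2`. -/
theorem stmt_19 (d : ℕ) (hd : 0 < d) (g : ↥Sol2 → Circle) (hg : Continuous g)
    (h : ∀ x : ↥Sol2, g x ^ d = x.1 0) : ∃ k : ℕ, d = 2 ^ k := by
  have hd' : (d : ℝ) ≠ 0 := by exact_mod_cast hd.ne'
  have hform := Circle.eq_mul_exp_div_of_pow_eq hd (hg.comp Sol2.continuous_path)
    (fun t => by simp [h, Sol2.path])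
  have hlim : Tendsto (fun n : ℕ => Circle.exp (2 ^ n * (2 * Real.pi) / d)) atTop (𝓝 1) := by
    have := ((hg.tendsto _).comp Sol2.tendsto_path_two_pow).const_mul (g (Sol2.path 0))⁻¹
    rw [inv_mul_cancel] at this
    refine this.congr fun n => ?_
    have hn := hform (2 ^ n * (2 * Real.pi))
    simp only [Function.comp_apply] at hn ⊢
    rw [hn, inv_mul_cancel_left]
  have hclosed : IsClosed ({z : Circle | z ^ d = 1} \ {1}) :=
    ((Circle.finite_setOf_pow_eq_one hd).subset Set.sdiff_subset).isClosed
  obtain ⟨n, hn⟩ := (hlim.eventually (hclosed.isOpen_compl.mem_nhds (by simp))).exists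
  have hroot : Circle.exp (2 ^ n * (2 * Real.pi) / d) ^ d = 1 := by
    rw [← Circle.exp_nsmul, nsmul_eq_mul, mul_div_cancel₀ _ hd']
    exact_mod_cast Circle.exp_int_mul_two_pi (2 ^ n)
  have hone : Circle.exp (2 ^ n * (2 * Real.pi) / d) = 1 := by
    by_contra hne
    exact hn ⟨hroot, hne⟩
  obtain ⟨m, hm⟩ := Circle.exp_eq_one.1 hone
  have hmul : (2 : ℝ) ^ n = d * m := by
    have hpi := Real.pi_ne_zero
    field_simp at hm
    linarith
  have hdvd : d ∣ 2 ^ n := by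
    have : (d : ℤ) ∣ ((2 ^ n : ℕ) : ℤ) := ⟨m, by exact_mod_cast hmul⟩
    exact_mod_cast this
  obtain ⟨k, -, hk⟩ := (Nat.dvd_prime_pow Nat.prime_two).1 hdvd
  exact ⟨k, hk⟩
end
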